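/- arXiv:1502.06511 — 2 statements merged into one kernel-verified Lean document; each statement's English description precedes it below -/
import Mathlib

section
/- Let u ∈ BV(ℝⁿ) be supported in the unit ball with |u| ≤ 1 and let u_ε = u ∗ γ_{n,ε} denote its convolution with the Gaussian of variance ε². Then there is a dimensional constant C such that ‖u_ε‖²_{H^{1/2}} ≤ C |log ε| ∫_{ℝⁿ} |∇u| for all 0 < ε < 1/2. -/
open MeasureTheory Set Real

/-- Divergence of a vector field on `ℝⁿ`. -/
noncomputable def diverg {n : ℕ}
    (φ : EuclideanSpace ℝ (Fin n) → EuclideanSpace ℝ (Fin n))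
    (x : EuclideanSpace ℝ (Fin n)) : ℝ :=
  ∑ i : Fin n, fderiv ℝ φ x (EuclideanSpace.single i 1) i

/-- The set of values `∫ u · div φ` over smooth compactly supported vector fields `φ`
with `‖φ‖ ≤ 1`; its supremum is the total variation `∫ |∇u|`. -/
def varSet {n : ℕ} (u : EuclideanSpace ℝ (Fin n) → ℝ) : Set ℝ :=
  {r | ∃ φ : EuclideanSpace ℝ (Fin n) → EuclideanSpace ℝ (Fin n),
    ContDiff ℝ (⊤ : ℕ∞) φ ∧ HasCompactSupport φ ∧ (∀ x, ‖φ x‖ ≤ 1) ∧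
    r = ∫ x, u x * diverg φ x}

/-- The total variation `∫_{ℝⁿ} |∇u|` of a function `u : ℝⁿ → ℝ`. -/
noncomputable def totalVar {n : ℕ} (u : EuclideanSpace ℝ (Fin n) → ℝ) : ℝ :=
  sSup (varSet u)

/-- `u ∈ BV(ℝⁿ)`: `u` is integrable and its distributional gradient has finite mass. -/
def IsBV {n : ℕ} (u : EuclideanSpace ℝ (Fin n) → ℝ) : Prop :=
  Integrable u ∧ BddAbove (varSet u)

/-- Standard Gaussian density on `ℝⁿ`. -/
noncomputable def gaussian (n : ℕ) (x : EuclideanSpace ℝ (Fin n)) : ℝ :=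
  (2 * π) ^ (-(n : ℝ) / 2) * exp (-‖x‖ ^ 2 / 2)

/-- Rescaled Gaussian `γ_{n,ε}(x) = ε^{-n} γ_n(x/ε)`. -/
noncomputable def gaussianScaled (n : ℕ) (ε : ℝ) (x : EuclideanSpace ℝ (Fin n)) : ℝ :=
  ε ^ (-(n : ℝ)) * gaussian n (ε⁻¹ • x)

/-- Gaussian mollification `u ∗ γ_{n,ε}`. -/
noncomputable def mollify {n : ℕ} (u : EuclideanSpace ℝ (Fin n) → ℝ) (ε : ℝ)
    (x : EuclideanSpace ℝ (Fin n)) : ℝ :=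
  ∫ y, u (x - y) * gaussianScaled n ε y

/-- The squared `H^{1/2}` norm `∫∫ |v(x)-v(y)|²/|x-y|^{n+1} dx dy` (in `[0,∞]`). -/
noncomputable def H12 {n : ℕ} (v : EuclideanSpace ℝ (Fin n) → ℝ) : ENNReal :=
  ∫⁻ x, ∫⁻ y, ENNReal.ofReal (|v x - v y| ^ 2 / ‖x - y‖ ^ (n + 1))

lemma IsBV.totalVar_nonneg {n : ℕ} {u : EuclideanSpace ℝ (Fin n) → ℝ} (hu : IsBV u) :
    0 ≤ totalVar u := by
  refine le_csSup hu.2 ⟨fun _ => 0, contDiff_const, HasCompactSupport.zero, by simp, ?_⟩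
  simp [diverg]

lemma diverg_smul_const {n : ℕ} {f : EuclideanSpace ℝ (Fin n) → ℝ}
    {x : EuclideanSpace ℝ (Fin n)} (hf : DifferentiableAt ℝ f x) (e : EuclideanSpace ℝ (Fin n)) :
    diverg (fun y => f y • e) x = fderiv ℝ f x e := by
  have h : fderiv ℝ (fun y => f y • e) x = (fderiv ℝ f x).smulRight e := fderiv_smul_const hf e
  have he : e = ∑ i, e i • EuclideanSpace.single i (1 : ℝ) := by
    ext j
    simp [Finset.sum_apply, Pi.single_apply]
  conv_rhs => rw [he]
  simp [diverg, h, map_sum, mul_comm]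

/-- Testing the distributional derivative of `u` in the direction `h`. -/
lemma IsBV.neg_integral_mul_fderiv_le {n : ℕ} {u : EuclideanSpace ℝ (Fin n) → ℝ} (hu : IsBV u)
    {ψ : EuclideanSpace ℝ (Fin n) → ℝ} (hψ : ContDiff ℝ (⊤ : ℕ∞) ψ) (hc : HasCompactSupport ψ)
    (h1 : ∀ x, |ψ x| ≤ 1) (h : EuclideanSpace ℝ (Fin n)) :
    ∫ x, u x * -(fderiv ℝ ψ x h) ≤ ‖h‖ * totalVar u := by
  rcases eq_or_ne h 0 with rfl | h0
  · simp
  have hpos : 0 < ‖h‖ := norm_pos_iff.2 h0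
  set e := -(‖h‖⁻¹ • h) with he
  have hen : ‖e‖ = 1 := by simp [he, norm_smul, hpos.ne']
  have hmem : ∫ x, u x * diverg (fun y => ψ y • e) x ≤ totalVar u := by
    refine le_csSup hu.2 ⟨fun y => ψ y • e, hψ.smul contDiff_const, hc.smul_right, ?_, rfl⟩
    intro x
    simpa [norm_smul, hen] using h1 x
  have hdiff : ∀ x, DifferentiableAt ℝ ψ x := fun x => hψ.differentiable (by simp) x
  calc ∫ x, u x * -(fderiv ℝ ψ x h)
      = ∫ x, ‖h‖ * (u x * diverg (fun y => ψ y • e) x) := by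
        congr 1; ext x
        rw [diverg_smul_const (hdiff x), he, map_neg, map_smul, smul_eq_mul]
        field_simp
    _ ≤ _ := by
        rw [integral_const_mul]
        gcongr

lemma IsBV.integral_mul_sub_translate_le {n : ℕ} {u : EuclideanSpace ℝ (Fin n) → ℝ} (hu : IsBV u)
    {ψ : EuclideanSpace ℝ (Fin n) → ℝ} (hψ : ContDiff ℝ (⊤ : ℕ∞) ψ) (hc : HasCompactSupport ψ)
    (h1 : ∀ x, |ψ x| ≤ 1) (h : EuclideanSpace ℝ (Fin n)) :
    (∫ x, u x * ψ (x - h)) - ∫ x, u x * ψ x ≤ ‖h‖ * totalVar u := by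
  have hdiff : Differentiable ℝ ψ := hψ.differentiable (by simp)
  have hfc : Continuous (fderiv ℝ ψ) := hψ.continuous_fderiv (by simp)
  obtain ⟨B, hB⟩ := (hc.fderiv ℝ).exists_bound_of_continuous hfc
  have hint (t : ℝ) : Integrable (fun x => u x * ψ (x - t • h)) := by
    refine hu.1.mul_bdd (c := 1) ?_ (.of_forall fun x => by simpa using h1 _)
    exact (hψ.continuous.comp (by fun_prop)).aestronglyMeasurable
  have hder (t : ℝ) : HasDerivAt (fun s : ℝ => ∫ x, u x * ψ (x - s • h))
      (∫ x, u x * -(fderiv ℝ ψ (x - t • h) h)) t := by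
    refine (hasDerivAt_integral_of_dominated_loc_of_deriv_le (s := univ)
      (F' := fun s x => u x * -(fderiv ℝ ψ (x - s • h) h))
      (bound := fun x => ‖u x‖ * (B * ‖h‖)) Filter.univ_mem
      (.of_forall fun s => (hint s).aestronglyMeasurable) (hint t) ?_ ?_ ?_ ?_).2
    · refine hu.1.aestronglyMeasurable.mul (Continuous.aestronglyMeasurable ?_)
      fun_prop
    · refine .of_forall fun x s _ => ?_
      rw [norm_mul, norm_neg]
      gcongr
      exact ((fderiv ℝ ψ (x - s • h)).le_opNorm h).trans (by gcongr; exact hB _)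
    · exact hu.1.norm.mul_const _
    · refine .of_forall fun x s _ => ?_
      have hl : HasDerivAt (fun s : ℝ => x - s • h) (-h) s := by
        simpa using ((hasDerivAt_id s).smul_const h).const_sub x
      simpa using (((hdiff _).hasFDerivAt.comp_hasDerivAt s hl).const_mul (u x))
  have key := image_sub_le_mul_sub_of_deriv_le (f := fun s : ℝ => ∫ x, u x * ψ (x - s • h))
    (C := ‖h‖ * totalVar u) (fun t => (hder t).differentiableAt) (fun t => ?_) zero_le_one
  · simpa using key
  · rw [(hder t).deriv]
    have := hu.neg_integral_mul_fderiv_le (ψ := fun x => ψ (x - t • h)) (hψ.comp (by fun_prop))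
      (by
        have := hc.comp_homeomorph (Homeomorph.subRight (t • h))
        exact this) (fun x => h1 _) h
    simpa [fderiv_comp_sub] using this

/-- Dual characterisation of the `L¹` norm by smooth compactly supported functions. -/
lemma integral_abs_le_of_forall_contDiff {E : Type*} [NormedAddCommGroup E] [NormedSpace ℝ E]
    [FiniteDimensional ℝ E] [MeasurableSpace E] [BorelSpace E] {μ : Measure E}
    [IsFiniteMeasureOnCompacts μ] {f : E → ℝ} (hf : Integrable f μ) {M : ℝ}
    (hM : ∀ ψ : E → ℝ, ContDiff ℝ (⊤ : ℕ∞) ψ → HasCompactSupport ψ → (∀ x, |ψ x| ≤ 1) →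
      ∫ x, f x * ψ x ∂μ ≤ M) :
    ∫ x, |f x| ∂μ ≤ M := by
  refine le_of_forall_pos_le_add fun δ' hδ' => ?_
  obtain ⟨δ, hδ, rfl⟩ : ∃ δ : ℝ, 0 < δ ∧ δ' = 3 * δ := ⟨δ' / 3, by positivity, by ring⟩
  obtain ⟨g, hgc, hgs, hg⟩ :=
    (memLp_one_iff_integrable.2 hf).exist_eLpNorm_sub_le ENNReal.one_ne_top le_rfl hδ
  have hgi : Integrable g μ := hgs.continuous.integrable_of_hasCompactSupport hgc
  have hfg : ∫ x, |f x - g x| ∂μ ≤ δ := by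
    have := integral_norm_eq_lintegral_enorm (hf.sub hgi).aestronglyMeasurable
    rw [eLpNorm_one_eq_lintegral_enorm] at hg
    calc ∫ x, |f x - g x| ∂μ = _ := this
      _ ≤ δ := ENNReal.toReal_le_of_le_ofReal hδ.le hg
  set V := μ.real (tsupport g)
  have hV : 0 ≤ V := measureReal_nonneg
  set η := δ / (V + 1) with hη
  have hη0 : 0 < η := by positivity
  have hηV : η * V ≤ δ := by
    rw [hη, div_mul_eq_mul_div, div_le_iff₀ (by positivity)]
    nlinarith
  have hq (x : E) : 0 < g x ^ 2 + η ^ 2 := by positivity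
  set ψ : E → ℝ := fun x => g x * (√(g x ^ 2 + η ^ 2))⁻¹ with hψ
  have hψs : ContDiff ℝ (⊤ : ℕ∞) ψ := by
    refine hgs.mul (ContDiff.inv (ContDiff.sqrt (by fun_prop) fun x => (hq x).ne') fun x => ?_)
    exact (Real.sqrt_pos.2 (hq x)).ne'
  have hψc : HasCompactSupport ψ := hgc.mul_right
  have hψ1 (x : E) : |ψ x| ≤ 1 := by
    rw [hψ]
    simp only [abs_mul, abs_inv, abs_of_nonneg (Real.sqrt_nonneg _)]
    rw [← div_eq_mul_inv, div_le_one (Real.sqrt_pos.2 (hq x))]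
    exact Real.abs_le_sqrt (by nlinarith)
  have hgψ (x : E) : |g x| - η ≤ g x * ψ x := by
    have hs := Real.sq_sqrt (hq x).le
    have hs0 := Real.sqrt_pos.2 (hq x)
    have h1 : |g x| ≤ √(g x ^ 2 + η ^ 2) := Real.abs_le_sqrt (by nlinarith)
    have h2 : η ≤ √(g x ^ 2 + η ^ 2) := Real.le_sqrt_of_sq_le (by nlinarith)
    have h3 : g x * ψ x = g x ^ 2 / √(g x ^ 2 + η ^ 2) := by rw [hψ]; ring
    rw [h3, le_div_iff₀ hs0]
    have h4 := sq_abs (g x)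
    have h5 := abs_nonneg (g x)
    nlinarith
  have hpt (x : E) : |f x| ≤ f x * ψ x + 2 * |f x - g x| + (tsupport g).indicator (fun _ => η) x := by
    have h1 : |f x| ≤ |g x| + |f x - g x| := by
      have := abs_add_le (g x) (f x - g x); simpa using this
    have h2 : g x * ψ x ≤ f x * ψ x + |f x - g x| := by
      have h3 : |(g x - f x) * ψ x| ≤ |f x - g x| := by
        rw [abs_mul, abs_sub_comm]
        exact mul_le_of_le_one_right (abs_nonneg _) (hψ1 x)
      nlinarith [le_abs_self ((g x - f x) * ψ x)]
    by_cases hx : x ∈ tsupport g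
    · rw [indicator_of_mem hx]
      linarith [hgψ x]
    · rw [indicator_of_notMem hx]
      have h0 : g x = 0 := image_eq_zero_of_notMem_tsupport hx
      rw [h0] at h1 h2 ⊢
      simp only [abs_zero, zero_mul] at h1 h2
      linarith
  have hi1 : Integrable (fun x => f x * ψ x) μ :=
    hf.mul_bdd (c := 1) hψs.continuous.aestronglyMeasurable (.of_forall hψ1)
  have hi2 : Integrable (fun x => 2 * |f x - g x|) μ := ((hf.sub hgi).norm).const_mul 2
  have hms : MeasurableSet (tsupport g) := (isClosed_tsupport g).measurableSet
  have hi3 : Integrable ((tsupport g).indicator (fun _ => η)) μ :=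
    (integrable_indicator_iff hms).2 (integrableOn_const hgc.measure_lt_top.ne)
  calc ∫ x, |f x| ∂μ
      ≤ ∫ x, f x * ψ x + 2 * |f x - g x| + (tsupport g).indicator (fun _ => η) x ∂μ :=
        integral_mono hf.abs ((hi1.add hi2).add hi3) hpt
    _ = (∫ x, f x * ψ x ∂μ) + 2 * (∫ x, |f x - g x| ∂μ) + V * η := by
        rw [integral_add (by exact hi1.add hi2) hi3, integral_add hi1 hi2, integral_const_mul,
          integral_indicator hms]
        simp [V]
    _ ≤ M + 3 * δ := by
        have := hM ψ hψs hψc hψ1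
        linarith [mul_comm V η]

lemma IsBV.integral_abs_translate_sub_le {n : ℕ} {u : EuclideanSpace ℝ (Fin n) → ℝ} (hu : IsBV u)
    (h : EuclideanSpace ℝ (Fin n)) :
    ∫ x, |u (x + h) - u x| ≤ ‖h‖ * totalVar u := by
  have huh : Integrable fun x => u (x + h) := hu.1.comp_add_right h
  refine integral_abs_le_of_forall_contDiff (huh.sub hu.1) fun ψ hψ hc h1 => ?_
  have hb : ∀ᵐ x : EuclideanSpace ℝ (Fin n), ‖ψ x‖ ≤ 1 := .of_forall h1
  have hm : AEStronglyMeasurable ψ volume := hψ.continuous.aestronglyMeasurable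
  calc ∫ x, (u (x + h) - u x) * ψ x
      = (∫ x, u (x + h) * ψ x) - ∫ x, u x * ψ x := by
        rw [← integral_sub (huh.mul_bdd hm hb) (hu.1.mul_bdd hm hb)]
        simp only [sub_mul]
    _ = (∫ x, u x * ψ (x - h)) - ∫ x, u x * ψ x := by
        rw [← integral_add_right_eq_self (fun x => u x * ψ (x - h)) h]
        simp
    _ ≤ _ := hu.integral_mul_sub_translate_le hψ hc h1 h

/-- Poincaré inequality for functions supported in the unit ball. -/
lemma IsBV.integral_abs_le_of_support_subset {n : ℕ} (hn : 0 < n)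
    {u : EuclideanSpace ℝ (Fin n) → ℝ} (hu : IsBV u)
    (hs : Function.support u ⊆ Metric.closedBall 0 1) :
    2 * ∫ x, |u x| ≤ 3 * totalVar u := by
  set h : EuclideanSpace ℝ (Fin n) := EuclideanSpace.single ⟨0, hn⟩ (3 : ℝ) with hh
  have hn3 : ‖h‖ = 3 := by simp [hh]
  have huh : Integrable fun x => u (x + h) := hu.1.comp_add_right h
  have hz (x) (hx : u x ≠ 0) : ‖x‖ ≤ 1 := by simpa using hs hx
  calc 2 * ∫ x, |u x| = ∫ x, (|u (x + h)| + |u x|) := by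
        rw [integral_add huh.abs hu.1.abs, integral_add_right_eq_self (fun x => |u x|) h, two_mul]
    _ = ∫ x, |u (x + h) - u x| := by
        congr 1; ext x
        by_cases h1 : u x = 0
        · simp [h1]
        by_cases h2 : u (x + h) = 0
        · simp [h2]
        have := norm_sub_le (x + h) x
        rw [add_sub_cancel_left, hn3] at this
        linarith [hz _ h1, hz _ h2]
    _ ≤ 3 * totalVar u := hn3 ▸ hu.integral_abs_translate_sub_le h

/-- Young's inequality `‖f ∗ g‖₁ ≤ ‖f‖₁ ‖g‖₁`. -/
lemma lintegral_enorm_integral_sub_mul_le {E : Type*} [NormedAddCommGroup E] [NormedSpace ℝ E]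
    [FiniteDimensional ℝ E] [MeasurableSpace E] [BorelSpace E] {μ : Measure E} [μ.IsAddHaarMeasure]
    {f g : E → ℝ} (hf : AEStronglyMeasurable f μ) (hg : AEStronglyMeasurable g μ) :
    ∫⁻ x, ‖∫ y, f (x - y) * g y ∂μ‖ₑ ∂μ ≤ (∫⁻ x, ‖f x‖ₑ ∂μ) * ∫⁻ y, ‖g y‖ₑ ∂μ := by
  have hm : AEMeasurable (Function.uncurry fun x y => ‖f (x - y) * g y‖ₑ) (μ.prod μ) := by
    have := (hg.convolution_integrand (ContinuousLinearMap.mul ℝ ℝ) hf (μ := μ)).enorm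
    simpa [Function.uncurry_def, mul_comm] using this
  calc ∫⁻ x, ‖∫ y, f (x - y) * g y ∂μ‖ₑ ∂μ
      ≤ ∫⁻ x, ∫⁻ y, ‖f (x - y) * g y‖ₑ ∂μ ∂μ :=
        lintegral_mono fun x => enorm_integral_le_lintegral_enorm _
    _ = ∫⁻ y, ∫⁻ x, ‖f (x - y) * g y‖ₑ ∂μ ∂μ := lintegral_lintegral_swap hm
    _ = ∫⁻ y, (∫⁻ x, ‖f x‖ₑ ∂μ) * ‖g y‖ₑ ∂μ := by
        congr 1; ext y
        simp only [enorm_mul]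
        rw [lintegral_mul_const' _ _ enorm_ne_top, lintegral_sub_right_eq_self (fun x => ‖f x‖ₑ) y]
    _ = _ := lintegral_const_mul'' _ hg.enorm

lemma abs_exp_neg_sub_exp_neg_le (a b : ℝ) :
    |exp (-a) - exp (-b)| ≤ |a - b| * (exp (-a) + exp (-b)) := by
  wlog hab : a ≤ b generalizing a b
  · rw [abs_sub_comm, abs_sub_comm a b, add_comm]
    exact this b a (le_of_not_ge hab)
  have h1 : exp (-b) ≤ exp (-a) := exp_le_exp.2 (by linarith)
  rw [abs_of_nonneg (by linarith), abs_of_nonpos (by linarith)]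
  have h2 : exp (-b) = exp (-a) * exp (a - b) := by rw [← exp_add]; ring_nf
  have h3 := add_one_le_exp (a - b)
  have h4 := exp_pos (-a)
  have h5 := exp_pos (-b)
  nlinarith

section Gaussian

variable {n : ℕ}

lemma gaussian_nonneg (x : EuclideanSpace ℝ (Fin n)) : 0 ≤ gaussian n x := by
  unfold gaussian
  positivity

lemma continuous_gaussian : Continuous (gaussian n) := by
  unfold gaussian
  fun_prop

lemma integrable_exp_neg_mul_sq_norm {b : ℝ} (hb : 0 < b) :
    Integrable fun x : EuclideanSpace ℝ (Fin n) => exp (-b * ‖x‖ ^ 2) := by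
  have h := (GaussianFourier.integrable_cexp_neg_mul_sq_norm_add (b := (b : ℂ)) (by simpa) 0
    (0 : EuclideanSpace ℝ (Fin n))).norm
  refine h.congr (.of_forall fun x => ?_)
  simp [Complex.norm_exp, ← Complex.ofReal_pow]

lemma integrable_gaussian : Integrable (gaussian n) := by
  refine ((integrable_exp_neg_mul_sq_norm (b := 1 / 2) (by norm_num)).const_mul
    ((2 * π) ^ (-(n : ℝ) / 2))).congr (.of_forall fun x => ?_)
  simp only [gaussian]
  ring_nf

lemma integrable_norm_mul_gaussian :
    Integrable fun x : EuclideanSpace ℝ (Fin n) => ‖x‖ * gaussian n x := by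
  refine ((integrable_exp_neg_mul_sq_norm (b := 1 / 4) (by norm_num)).const_mul
    ((2 * π) ^ (-(n : ℝ) / 2))).mono'
    (continuous_norm.mul continuous_gaussian).aestronglyMeasurable (.of_forall fun x => ?_)
  rw [norm_mul, norm_norm, Real.norm_of_nonneg (gaussian_nonneg x), gaussian, mul_left_comm]
  gcongr
  have h1 : ‖x‖ ≤ exp (1 / 4 * ‖x‖ ^ 2) := by
    nlinarith [add_one_le_exp (1 / 4 * ‖x‖ ^ 2), sq_nonneg (‖x‖ / 2 - 1)]
  calc ‖x‖ * exp (-‖x‖ ^ 2 / 2) ≤ exp (1 / 4 * ‖x‖ ^ 2) * exp (-‖x‖ ^ 2 / 2) := by gcongr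
    _ = _ := by rw [← exp_add]; ring_nf

lemma abs_gaussian_add_sub_le (x k : EuclideanSpace ℝ (Fin n)) :
    |gaussian n (x + k) - gaussian n x| ≤
      ‖k‖ * ((‖x + k‖ + ‖k‖ / 2) * gaussian n (x + k) + (‖x‖ + ‖k‖ / 2) * gaussian n x) := by
  set c : ℝ := (2 * π) ^ (-(n : ℝ) / 2)
  have hc : 0 ≤ c := by positivity
  have h1 : ‖x + k‖ ≤ ‖x‖ + ‖k‖ := norm_add_le _ _
  have h2 : ‖x‖ ≤ ‖x + k‖ + ‖k‖ := by
    simpa using norm_sub_le (x + k) k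
  have h := abs_exp_neg_sub_exp_neg_le (‖x + k‖ ^ 2 / 2) (‖x‖ ^ 2 / 2)
  have e (y : EuclideanSpace ℝ (Fin n)) : gaussian n y = c * exp (-(‖y‖ ^ 2 / 2)) := by
    simp only [gaussian, neg_div, c]
  have hd : |‖x + k‖ ^ 2 / 2 - ‖x‖ ^ 2 / 2| ≤ ‖k‖ * ((‖x + k‖ + ‖x‖) / 2) := by
    have : ‖x + k‖ ^ 2 / 2 - ‖x‖ ^ 2 / 2 = (‖x + k‖ - ‖x‖) * ((‖x + k‖ + ‖x‖) / 2) := by ring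
    rw [this, abs_mul, abs_of_nonneg (by positivity : 0 ≤ (‖x + k‖ + ‖x‖) / 2)]
    gcongr
    rw [abs_le]
    constructor <;> linarith
  rw [e, e, ← mul_sub, abs_mul, abs_of_nonneg hc]
  calc c * |exp (-(‖x + k‖ ^ 2 / 2)) - exp (-(‖x‖ ^ 2 / 2))|
      ≤ c * (‖k‖ * ((‖x + k‖ + ‖x‖) / 2) *
          (exp (-(‖x + k‖ ^ 2 / 2)) + exp (-(‖x‖ ^ 2 / 2)))) := by
        gcongr
        exact h.trans (by gcongr)
    _ = ‖k‖ * ((‖x + k‖ + ‖x‖) / 2 * (c * exp (-(‖x + k‖ ^ 2 / 2))) +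
          (‖x + k‖ + ‖x‖) / 2 * (c * exp (-(‖x‖ ^ 2 / 2)))) := by ring
    _ ≤ _ := by
        gcongr <;> linarith

/-- Modulus of continuity of translations of the Gaussian in `L¹`. -/
lemma exists_integral_abs_gaussian_add_sub_le (n : ℕ) :
    ∃ K : ℝ, 0 ≤ K ∧ ∀ k : EuclideanSpace ℝ (Fin n), ‖k‖ ≤ 1 →
      ∫ x, |gaussian n (x + k) - gaussian n x| ≤ K * ‖k‖ := by
  set P := ∫ x, ‖x‖ * gaussian n x
  set m := ∫ x, gaussian n x
  have hP : 0 ≤ P := integral_nonneg fun x => mul_nonneg (norm_nonneg _) (gaussian_nonneg x)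
  have hm : 0 ≤ m := integral_nonneg gaussian_nonneg
  refine ⟨2 * P + m, by positivity, fun k hk => ?_⟩
  set F : EuclideanSpace ℝ (Fin n) → ℝ := fun x => (‖x‖ + ‖k‖ / 2) * gaussian n x with hF
  have hFi : Integrable F := by
    refine (integrable_norm_mul_gaussian.add (integrable_gaussian.const_mul (‖k‖ / 2))).congr
      (.of_forall fun x => ?_)
    simp only [hF, Pi.add_apply]
    ring
  have hFv : ∫ x, F x = P + ‖k‖ / 2 * m := by
    rw [← integral_const_mul, ← integral_add integrable_norm_mul_gaussian
      (integrable_gaussian.const_mul _)]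
    congr 1; ext x
    simp only [hF]
    ring
  have hFk : Integrable fun x => F (x + k) := hFi.comp_add_right k
  calc ∫ x, |gaussian n (x + k) - gaussian n x|
      ≤ ∫ x, ‖k‖ * (F (x + k) + F x) := by
        refine integral_mono ((integrable_gaussian.comp_add_right k).sub integrable_gaussian).abs
          ((hFk.add hFi).const_mul _) fun x => abs_gaussian_add_sub_le x k
    _ = ‖k‖ * (2 * P + ‖k‖ * m) := by
        rw [integral_const_mul, integral_add hFk hFi, integral_add_right_eq_self F k, hFv]
        ring
    _ ≤ ‖k‖ * (2 * P + 1 * m) := by gcongr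
    _ = _ := by ring

variable {ε : ℝ}

lemma integral_rpow_mul_comp_inv_smul (hε : 0 < ε) (F : EuclideanSpace ℝ (Fin n) → ℝ) :
    ∫ x, ε ^ (-(n : ℝ)) * F (ε⁻¹ • x) = ∫ x, F x := by
  rw [integral_const_mul, Measure.integral_comp_inv_smul_of_nonneg _ _ hε.le,
    finrank_euclideanSpace_fin, smul_eq_mul, ← mul_assoc, Real.rpow_neg hε.le, Real.rpow_natCast,
    inv_mul_cancel₀ (by positivity), one_mul]

lemma gaussianScaled_nonneg (hε : 0 < ε) (x : EuclideanSpace ℝ (Fin n)) :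
    0 ≤ gaussianScaled n ε x :=
  mul_nonneg (by positivity) (gaussian_nonneg _)

lemma integrable_gaussianScaled (hε : 0 < ε) : Integrable (gaussianScaled n ε) :=
  (integrable_gaussian.comp_smul (inv_ne_zero hε.ne')).const_mul _

lemma integral_gaussianScaled (hε : 0 < ε) :
    ∫ x, gaussianScaled n ε x = ∫ x, gaussian n x :=
  integral_rpow_mul_comp_inv_smul hε _

lemma integral_abs_gaussianScaled_add_sub (hε : 0 < ε) (h : EuclideanSpace ℝ (Fin n)) :
    ∫ x, |gaussianScaled n ε (x + h) - gaussianScaled n ε x| =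
      ∫ x, |gaussian n (x + ε⁻¹ • h) - gaussian n x| := by
  rw [← integral_rpow_mul_comp_inv_smul hε fun x => |gaussian n (x + ε⁻¹ • h) - gaussian n x|]
  congr 1; ext x
  rw [gaussianScaled, gaussianScaled, smul_add, ← mul_sub, abs_mul, abs_of_nonneg (by positivity)]

end Gaussian

section Mollify

variable {n : ℕ} {u : EuclideanSpace ℝ (Fin n) → ℝ} {ε : ℝ}

lemma integrable_comp_sub_mul (hu : AEStronglyMeasurable u) (h1 : ∀ x, |u x| ≤ 1)
    {g : EuclideanSpace ℝ (Fin n) → ℝ} (hg : Integrable g) (x : EuclideanSpace ℝ (Fin n)) :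
    Integrable fun y => u (x - y) * g y :=
  hg.bdd_mul (c := 1)
    (hu.comp_quasiMeasurePreserving (quasiMeasurePreserving_sub_left_of_right_invariant volume x))
    (.of_forall fun _ => h1 _)

lemma abs_integral_comp_sub_mul_le (h1 : ∀ x, |u x| ≤ 1)
    {g : EuclideanSpace ℝ (Fin n) → ℝ} (hg : Integrable g) (x : EuclideanSpace ℝ (Fin n)) :
    |∫ y, u (x - y) * g y| ≤ ∫ y, |g y| := by
  rw [← Real.norm_eq_abs]
  refine norm_integral_le_of_norm_le hg.abs (.of_forall fun y => ?_)
  rw [norm_mul]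
  exact mul_le_of_le_one_left (abs_nonneg _) (h1 _)

lemma abs_mollify_le (h1 : ∀ x, |u x| ≤ 1) (hε : 0 < ε) (x : EuclideanSpace ℝ (Fin n)) :
    |mollify u ε x| ≤ ∫ y, gaussian n y := by
  refine (abs_integral_comp_sub_mul_le h1 (integrable_gaussianScaled hε) x).trans_eq ?_
  rw [← integral_gaussianScaled hε]
  simp only [abs_of_nonneg (gaussianScaled_nonneg hε _)]

lemma abs_mollify_add_sub_le (hu : AEStronglyMeasurable u) (h1 : ∀ x, |u x| ≤ 1) (hε : 0 < ε)
    (x h : EuclideanSpace ℝ (Fin n)) :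
    |mollify u ε (x + h) - mollify u ε x| ≤
      ∫ y, |gaussian n (y + ε⁻¹ • h) - gaussian n y| := by
  have hg := integrable_gaussianScaled (n := n) hε
  have hgh : Integrable fun y => gaussianScaled n ε (y + h) := hg.comp_add_right h
  have : mollify u ε (x + h) - mollify u ε x =
      ∫ y, u (x - y) * (gaussianScaled n ε (y + h) - gaussianScaled n ε y) := by
    simp only [mul_sub]
    rw [integral_sub (integrable_comp_sub_mul hu h1 hgh x) (integrable_comp_sub_mul hu h1 hg x),
      mollify, mollify,
      ← integral_add_right_eq_self (fun y => u (x + h - y) * gaussianScaled n ε y) h]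
    simp
  rw [this, ← integral_abs_gaussianScaled_add_sub hε]
  exact abs_integral_comp_sub_mul_le h1 (hgh.sub hg) x

lemma continuous_mollify (hu : AEStronglyMeasurable u) (h1 : ∀ x, |u x| ≤ 1) (hε : 0 < ε) :
    Continuous (mollify u ε) := by
  obtain ⟨K, hK0, hK⟩ := exists_integral_abs_gaussian_add_sub_le n
  rw [continuous_iff_continuousAt]
  intro x
  rw [ContinuousAt, tendsto_iff_norm_sub_tendsto_zero]
  have hlim : Filter.Tendsto (fun y => K * ‖ε⁻¹ • (y - x)‖) (nhds x) (nhds 0) := by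
    have : Continuous fun y => K * ‖ε⁻¹ • (y - x)‖ := by fun_prop
    simpa using this.tendsto x
  have hlim' : Filter.Tendsto (fun y => ‖ε⁻¹ • (y - x)‖) (nhds x) (nhds 0) := by
    have : Continuous fun y => ‖ε⁻¹ • (y - x)‖ := by fun_prop
    simpa using this.tendsto x
  refine squeeze_zero' (.of_forall fun _ => norm_nonneg _) ?_ hlim
  filter_upwards [hlim'.eventually (eventually_le_nhds zero_lt_one)] with y hy
  have := abs_mollify_add_sub_le hu h1 hε x (y - x)
  rw [add_sub_cancel] at this
  exact this.trans (hK _ hy)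

lemma lintegral_abs_mollify_add_sub_le (hu : Integrable u) (h1 : ∀ x, |u x| ≤ 1) (hε : 0 < ε)
    (h : EuclideanSpace ℝ (Fin n)) :
    ∫⁻ x, ENNReal.ofReal |mollify u ε (x + h) - mollify u ε x| ≤
      ENNReal.ofReal ((∫ x, |u (x + h) - u x|) * ∫ y, gaussian n y) := by
  have hg := integrable_gaussianScaled (n := n) hε
  have huh : Integrable fun x => u (x + h) := hu.comp_add_right h
  have hd : Integrable fun x => u (x + h) - u x := huh.sub hu
  calc ∫⁻ x, ENNReal.ofReal |mollify u ε (x + h) - mollify u ε x|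
      = ∫⁻ x, ‖∫ y, (u (x - y + h) - u (x - y)) * gaussianScaled n ε y‖ₑ := by
        congr 1; ext x
        rw [← Real.norm_eq_abs, ofReal_norm, mollify, mollify, ← integral_sub
          (integrable_comp_sub_mul hu.aestronglyMeasurable h1 hg _)
          (integrable_comp_sub_mul hu.aestronglyMeasurable h1 hg _)]
        simp only [sub_mul, sub_add_eq_add_sub]
    _ ≤ _ := lintegral_enorm_integral_sub_mul_le (f := fun x => u (x + h) - u x)
          hd.aestronglyMeasurable hg.aestronglyMeasurable
    _ = _ := by
        rw [ENNReal.ofReal_mul (integral_nonneg fun _ => abs_nonneg _),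
          ← ofReal_integral_norm_eq_lintegral_enorm hd, ← ofReal_integral_norm_eq_lintegral_enorm hg,
          ← integral_gaussianScaled hε]
        simp only [Real.norm_of_nonneg (gaussianScaled_nonneg hε _), Real.norm_eq_abs]

end Mollify

/-- The radial profile equal to `1 / ε` on `(0, ε]`, to `1 / r` on `(ε, 1]` and to `1 / r ^ 2`
beyond. -/
noncomputable def radialProfile (ε r : ℝ) : ℝ :=
  if r ≤ ε then ε⁻¹ else if r ≤ 1 then r⁻¹ else r ^ (-2 : ℝ)

lemma radialProfile_nonneg {ε r : ℝ} (hε : 0 < ε) (hr : 0 ≤ r) : 0 ≤ radialProfile ε r := by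
  unfold radialProfile
  split_ifs <;> positivity

lemma integrableOn_radialProfile_and_integral {ε : ℝ} (hε : 0 < ε) (hε1 : ε ≤ 1) :
    IntegrableOn (radialProfile ε) (Ioi 0) ∧ ∫ r in Ioi 0, radialProfile ε r = 2 - log ε := by
  have e1 : EqOn (radialProfile ε) (fun _ => ε⁻¹) (Ioc 0 ε) := fun r hr => by
    simp [radialProfile, hr.2]
  have e2 : EqOn (radialProfile ε) (fun r => r⁻¹) (Ioc ε 1) := fun r hr => by
    simp [radialProfile, hr.2, hr.1]
  have e3 : EqOn (radialProfile ε) (fun r => r ^ (-2 : ℝ)) (Ioi 1) := fun r (hr : 1 < r) => by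
    simp [radialProfile, hr.not_ge, (hε1.trans_lt hr).not_ge]
  have i1 : IntegrableOn (radialProfile ε) (Ioc 0 ε) :=
    (integrableOn_congr_fun e1 measurableSet_Ioc).2 (integrableOn_const (by simp))
  have i2 : IntegrableOn (radialProfile ε) (Ioc ε 1) := by
    refine (integrableOn_congr_fun e2 measurableSet_Ioc).2 ?_
    rw [← intervalIntegrable_iff_integrableOn_Ioc_of_le hε1]
    refine intervalIntegrable_inv_iff.2 (Or.inr ?_)
    rw [uIcc_of_le hε1]
    exact fun h => hε.not_ge h.1
  have i3 : IntegrableOn (radialProfile ε) (Ioi 1) :=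
    (integrableOn_congr_fun e3 measurableSet_Ioi).2
      (integrableOn_Ioi_rpow_of_lt (by norm_num) one_pos)
  have v1 : ∫ r in Ioc 0 ε, radialProfile ε r = 1 := by
    rw [setIntegral_congr_fun measurableSet_Ioc e1]
    simp [hε.le, hε.ne']
  have v2 : ∫ r in Ioc ε 1, radialProfile ε r = -log ε := by
    rw [setIntegral_congr_fun measurableSet_Ioc e2, ← intervalIntegral.integral_of_le hε1,
      integral_inv_of_pos hε one_pos, one_div, log_inv]
  have v3 : ∫ r in Ioi 1, radialProfile ε r = 1 := by
    rw [setIntegral_congr_fun measurableSet_Ioi e3, integral_Ioi_rpow_of_lt (by norm_num) one_pos]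
    norm_num
  have i23 := i2.union i3
  rw [Ioc_union_Ioi_eq_Ioi hε1] at i23
  have i123 := i1.union i23
  rw [Ioc_union_Ioi_eq_Ioi hε.le] at i123
  refine ⟨i123, ?_⟩
  rw [← Ioc_union_Ioi_eq_Ioi hε.le, setIntegral_union (Ioc_disjoint_Ioi le_rfl) measurableSet_Ioi
    i1 i23, ← Ioc_union_Ioi_eq_Ioi hε1, setIntegral_union (Ioc_disjoint_Ioi le_rfl)
    measurableSet_Ioi i2 i3, v1, v2, v3]
  ring

lemma lintegral_radialProfile_norm_div {n : ℕ} (hn : 0 < n) {ε : ℝ} (hε : 0 < ε) (hε1 : ε ≤ 1) :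
    ∫⁻ h : EuclideanSpace ℝ (Fin n), ENNReal.ofReal (radialProfile ε ‖h‖ / ‖h‖ ^ (n - 1)) =
      ENNReal.ofReal (n * volume.real (Metric.ball (0 : EuclideanSpace ℝ (Fin n)) 1) *
        (2 - log ε)) := by
  have : Nonempty (Fin n) := ⟨⟨0, hn⟩⟩
  obtain ⟨hi, hv⟩ := integrableOn_radialProfile_and_integral hε hε1
  have he : EqOn (fun r : ℝ => r ^ (Module.finrank ℝ (EuclideanSpace ℝ (Fin n)) - 1) •
      (radialProfile ε r / r ^ (n - 1))) (radialProfile ε) (Ioi 0) := by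
    intro r hr
    have : r ^ (n - 1) ≠ 0 := pow_ne_zero _ (ne_of_gt hr)
    simp only [finrank_euclideanSpace_fin, smul_eq_mul]
    field_simp
  have hint : Integrable fun h : EuclideanSpace ℝ (Fin n) =>
      radialProfile ε ‖h‖ / ‖h‖ ^ (n - 1) := by
    rw [integrable_fun_norm_addHaar volume (f := fun r => radialProfile ε r / r ^ (n - 1))]
    exact (integrableOn_congr_fun he measurableSet_Ioi).2 hi
  rw [← ofReal_integral_eq_lintegral_ofReal hint (.of_forall fun h =>
      div_nonneg (radialProfile_nonneg hε (norm_nonneg h)) (by positivity)),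
    integral_fun_norm_addHaar volume (fun r => radialProfile ε r / r ^ (n - 1)),
    setIntegral_congr_fun measurableSet_Ioi he, hv]
  simp [mul_assoc]

lemma H12_eq_lintegral_translate {n : ℕ} {v : EuclideanSpace ℝ (Fin n) → ℝ} (hv : Continuous v) :
    H12 v = ∫⁻ h, ∫⁻ x, ENNReal.ofReal (|v (x + h) - v x| ^ 2 / ‖h‖ ^ (n + 1)) := by
  have hm : Measurable (Function.uncurry fun x h : EuclideanSpace ℝ (Fin n) =>
      ENNReal.ofReal (|v (x + h) - v x| ^ 2 / ‖h‖ ^ (n + 1))) := by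
    refine ENNReal.measurable_ofReal.comp (Measurable.div ?_ ?_)
    · exact Continuous.measurable (by fun_prop)
    · exact Continuous.measurable (by fun_prop)
  rw [← lintegral_lintegral_swap hm.aemeasurable, H12]
  congr 1; ext x
  rw [← lintegral_add_left_eq_self _ x]
  simp [abs_sub_comm]

lemma IsBV.integral_abs_translate_sub_le_three {n : ℕ} (hn : 0 < n)
    {u : EuclideanSpace ℝ (Fin n) → ℝ} (hu : IsBV u)
    (hs : Function.support u ⊆ Metric.closedBall 0 1) (h : EuclideanSpace ℝ (Fin n)) :
    ∫ x, |u (x + h) - u x| ≤ 3 * totalVar u := by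
  have huh : Integrable fun x => u (x + h) := hu.1.comp_add_right h
  calc ∫ x, |u (x + h) - u x| ≤ ∫ x, (|u (x + h)| + |u x|) :=
        integral_mono (huh.sub hu.1).abs (huh.abs.add hu.1.abs) fun x => abs_sub _ _
    _ = 2 * ∫ x, |u x| := by
        rw [integral_add huh.abs hu.1.abs, integral_add_right_eq_self (fun x => |u x|) h, two_mul]
    _ ≤ _ := hu.integral_abs_le_of_support_subset hn hs

lemma lintegral_abs_mollify_sub_sq_div_le {n : ℕ} (hn : 0 < n) {K : ℝ} (hK0 : 0 ≤ K)
    (hK : ∀ k : EuclideanSpace ℝ (Fin n), ‖k‖ ≤ 1 →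
      ∫ x, |gaussian n (x + k) - gaussian n x| ≤ K * ‖k‖)
    {u : EuclideanSpace ℝ (Fin n) → ℝ} (hu : IsBV u) (h1 : ∀ x, |u x| ≤ 1)
    (hs : Function.support u ⊆ Metric.closedBall 0 1) {ε : ℝ} (hε : 0 < ε)
    {h : EuclideanSpace ℝ (Fin n)} (h0 : h ≠ 0) :
    ∫⁻ x, ENNReal.ofReal (|mollify u ε (x + h) - mollify u ε x| ^ 2 / ‖h‖ ^ (n + 1)) ≤
      ENNReal.ofReal ((∫ y, gaussian n y) * (K + 6 * ∫ y, gaussian n y) * totalVar u) *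
        ENNReal.ofReal (radialProfile ε ‖h‖ / ‖h‖ ^ (n - 1)) := by
  set m := ∫ y, gaussian n y
  have hm : 0 ≤ m := integral_nonneg gaussian_nonneg
  have hT := hu.totalVar_nonneg
  set T := totalVar u
  set r := ‖h‖
  have hr : 0 < r := norm_pos_iff.2 h0
  have key (S L : ℝ) (hS0 : 0 ≤ S) (hS : ∀ x, |mollify u ε (x + h) - mollify u ε x| ≤ S)
      (hL : ∫ x, |u (x + h) - u x| ≤ L * T)
      (hSL : S * L ≤ (K + 6 * m) * (radialProfile ε r * r ^ 2)) :
      ∫⁻ x, ENNReal.ofReal (|mollify u ε (x + h) - mollify u ε x| ^ 2 / r ^ (n + 1)) ≤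
        ENNReal.ofReal (m * (K + 6 * m) * T) *
          ENNReal.ofReal (radialProfile ε r / r ^ (n - 1)) := by
    calc ∫⁻ x, ENNReal.ofReal (|mollify u ε (x + h) - mollify u ε x| ^ 2 / r ^ (n + 1))
        ≤ ∫⁻ x, ENNReal.ofReal (S / r ^ (n + 1)) *
            ENNReal.ofReal |mollify u ε (x + h) - mollify u ε x| := by
          refine lintegral_mono fun x => ?_
          rw [← ENNReal.ofReal_mul (by positivity), div_mul_eq_mul_div]
          gcongr
          rw [sq]
          gcongr
          exact hS x
      _ = ENNReal.ofReal (S / r ^ (n + 1)) *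
            ∫⁻ x, ENNReal.ofReal |mollify u ε (x + h) - mollify u ε x| :=
          lintegral_const_mul' _ _ ENNReal.ofReal_ne_top
      _ ≤ ENNReal.ofReal (S / r ^ (n + 1)) * ENNReal.ofReal (L * T * m) := by
          gcongr
          exact (lintegral_abs_mollify_add_sub_le hu.1 h1 hε h).trans (by gcongr)
      _ ≤ _ := by
          rw [← ENNReal.ofReal_mul (by positivity), ← ENNReal.ofReal_mul (by positivity)]
          refine ENNReal.ofReal_le_ofReal ?_
          have hp : r ^ (n + 1) = r ^ (n - 1) * r ^ 2 := by
            rw [← pow_add]; congr 1; omega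
          calc S / r ^ (n + 1) * (L * T * m) = S * L * (T * m / r ^ (n + 1)) := by ring
            _ ≤ (K + 6 * m) * (radialProfile ε r * r ^ 2) * (T * m / r ^ (n + 1)) := by gcongr
            _ = _ := by
              rw [hp]
              field_simp
  have hL1 := hu.integral_abs_translate_sub_le h
  have hL3 := hu.integral_abs_translate_sub_le_three hn hs h
  have hS2 (x) : |mollify u ε (x + h) - mollify u ε x| ≤ 2 * m := by
    linarith [abs_sub (mollify u ε (x + h)) (mollify u ε x), abs_mollify_le h1 hε x,
      abs_mollify_le h1 hε (x + h)]
  rcases le_or_gt r ε with hrε | hrε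
  · have hk : ‖ε⁻¹ • h‖ = ε⁻¹ * r := by
      rw [norm_smul, norm_inv, Real.norm_of_nonneg hε.le]
    refine key (K * (ε⁻¹ * r)) r (by positivity) (fun x => ?_) hL1 ?_
    · refine (abs_mollify_add_sub_le hu.1.aestronglyMeasurable h1 hε x h).trans ?_
      rw [← hk]
      refine hK _ ?_
      rw [hk, ← div_eq_inv_mul]
      exact div_le_one_of_le₀ hrε hε.le
    · rw [radialProfile, if_pos hrε]
      have : 0 ≤ m * (ε⁻¹ * r ^ 2) := by positivity
      nlinarith
  rcases le_or_gt r 1 with hr1 | hr1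
  · refine key (2 * m) r (by positivity) hS2 hL1 ?_
    rw [radialProfile, if_neg hrε.not_ge, if_pos hr1, sq, inv_mul_cancel_left₀ hr.ne']
    gcongr
    linarith
  · refine key (2 * m) 3 (by positivity) hS2 hL3 ?_
    rw [radialProfile, if_neg hrε.not_ge, if_neg hr1.not_ge, Real.rpow_neg hr.le, Real.rpow_two,
      inv_mul_cancel₀ (by positivity)]
    linarith

/-- If `u ∈ BV(ℝⁿ)` is supported in the unit ball with `|u| ≤ 1`, then
`‖u ∗ γ_{n,ε}‖²_{H^{1/2}} ≤ C |log ε| ∫ |∇u|` for `0 < ε < 1/2`, with `C` dimensional. -/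
theorem H12_mollify_le {n : ℕ} :
    ∃ C : ℝ, 0 < C ∧ ∀ u : EuclideanSpace ℝ (Fin n) → ℝ,
      IsBV u → (∀ x, |u x| ≤ 1) → Function.support u ⊆ Metric.closedBall 0 1 →
      ∀ ε : ℝ, 0 < ε → ε < 1 / 2 →
        H12 (mollify u ε) ≤ ENNReal.ofReal (C * |log ε| * totalVar u) := by
  rcases Nat.eq_zero_or_pos n with rfl | hn
  · refine ⟨1, one_pos, fun u _ _ _ ε _ _ => ?_⟩
    simp [H12, Subsingleton.elim _ (0 : EuclideanSpace ℝ (Fin 0))]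
  obtain ⟨K, hK0, hK⟩ := exists_integral_abs_gaussian_add_sub_le n
  set m := ∫ y, gaussian n y
  set κ := n * volume.real (Metric.ball (0 : EuclideanSpace ℝ (Fin n)) 1)
  have hm : 0 ≤ m := integral_nonneg gaussian_nonneg
  have hκ : 0 ≤ κ := by positivity
  have hl2 : 0 < log 2 := log_pos one_lt_two
  refine ⟨m * (K + 6 * m) * (κ * (1 + 2 / log 2)) + 1, by positivity,
    fun u hu h1 hs ε hε hε2 => ?_⟩
  have hε1 : ε ≤ 1 := by linarith
  have hT := hu.totalVar_nonneg
  have : Nonempty (Fin n) := ⟨⟨0, hn⟩⟩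
  have hlog : log 2 ≤ |log ε| := by
    rw [abs_of_nonpos (log_nonpos hε.le hε1), ← log_inv]
    exact log_le_log two_pos ((le_inv_comm₀ two_pos hε).2 (by linarith))
  have hprofile : 2 - log ε ≤ (1 + 2 / log 2) * |log ε| := by
    have h2 : 2 ≤ 2 / log 2 * |log ε| := by
      rw [div_mul_eq_mul_div, le_div_iff₀ hl2]
      linarith
    linarith [neg_abs_le (log ε)]
  rw [H12_eq_lintegral_translate (continuous_mollify hu.1.aestronglyMeasurable h1 hε)]
  calc _ ≤ ∫⁻ h : EuclideanSpace ℝ (Fin n), ENNReal.ofReal (m * (K + 6 * m) * totalVar u) *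
        ENNReal.ofReal (radialProfile ε ‖h‖ / ‖h‖ ^ (n - 1)) := by
        refine lintegral_mono_ae ?_
        filter_upwards [Measure.ae_ne volume (0 : EuclideanSpace ℝ (Fin n))] with h h0
        exact lintegral_abs_mollify_sub_sq_div_le hn hK0 hK hu h1 hs hε h0
    _ = ENNReal.ofReal (m * (K + 6 * m) * totalVar u * (κ * (2 - log ε))) := by
        rw [lintegral_const_mul' _ _ ENNReal.ofReal_ne_top,
          lintegral_radialProfile_norm_div hn hε hε1, ← ENNReal.ofReal_mul (by positivity)]
    _ ≤ _ := by
        refine ENNReal.ofReal_le_ofReal ?_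
        calc m * (K + 6 * m) * totalVar u * (κ * (2 - log ε))
            ≤ m * (K + 6 * m) * totalVar u * (κ * ((1 + 2 / log 2) * |log ε|)) := by gcongr
          _ = m * (K + 6 * m) * (κ * (1 + 2 / log 2)) * |log ε| * totalVar u := by ring
          _ ≤ _ := by
            gcongr
            linarith
end

section
/- Let E ⊆ ℝⁿ, x, y ∈ E^{(1)} (points of density one), and suppose that for ℋⁿ-a.e. z in a neighborhood of y with z ∈ E ∩ (E − (x−y)), the segment [z, z+(x−y)] meets the complement of E in a set of ℋ¹-measure zero near any fixed point of the segment. Then for every t ∈ (0,1), the point t x + (1−t) y is also a point of density one of E. -/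
open MeasureTheory Set Filter

/-- The set `E^{(1)}` of density-one points of `E`. -/
def densityOne {n : ℕ} (E : Set (EuclideanSpace ℝ (Fin n))) :
    Set (EuclideanSpace ℝ (Fin n)) :=
  {x | Tendsto (fun r : ℝ => volume (E ∩ Metric.ball x r) / volume (Metric.ball x r))
    (nhdsWithin 0 (Ioi 0)) (nhds 1)}

/-- Density one is the vanishing of the relative density of the complement. -/
theorem mem_densityOne_iff {n : ℕ} {E : Set (EuclideanSpace ℝ (Fin n))}
    (hE : MeasurableSet E) (x : EuclideanSpace ℝ (Fin n)) :
    x ∈ densityOne E ↔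
      Tendsto (fun r : ℝ => volume (Metric.ball x r \ E) / volume (Metric.ball x r))
        (nhdsWithin 0 (Ioi 0)) (nhds 0) := by
  have key : ∀ r : ℝ, r ∈ Ioi (0 : ℝ) →
      volume (E ∩ Metric.ball x r) / volume (Metric.ball x r) +
        volume (Metric.ball x r \ E) / volume (Metric.ball x r) = 1 := by
    intro r hr
    rw [← ENNReal.add_div, inter_comm, measure_inter_add_sdiff _ hE]
    exact ENNReal.div_self (Metric.measure_ball_pos _ _ hr).ne' measure_ball_lt_top.ne
  have fin : ∀ {a b : ENNReal}, a + b = 1 → a = 1 - b ∧ b = 1 - a := by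
    intro a b h
    have ha : a ≠ ⊤ := ne_top_of_le_ne_top ENNReal.one_ne_top (h ▸ le_self_add)
    have hb : b ≠ ⊤ := ne_top_of_le_ne_top ENNReal.one_ne_top (h ▸ le_add_self)
    exact ⟨ENNReal.eq_sub_of_add_eq hb h, ENNReal.eq_sub_of_add_eq ha (by rwa [add_comm])⟩
  constructor
  · intro h
    have h1 := ENNReal.Tendsto.sub (tendsto_const_nhds (x := (1 : ENNReal))) h
      (Or.inl ENNReal.one_ne_top)
    rw [tsub_self] at h1
    refine h1.congr' ?_
    filter_upwards [self_mem_nhdsWithin] with r hr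
    exact (fin (key r hr)).2.symm
  · intro h
    have h1 := ENNReal.Tendsto.sub (tendsto_const_nhds (x := (1 : ENNReal))) h
      (Or.inl ENNReal.one_ne_top)
    rw [tsub_zero] at h1
    refine h1.congr' ?_
    filter_upwards [self_mem_nhdsWithin] with r hr
    exact (fin (key r hr)).1.symm

/-- If the part of `A` on the segment `[z, z + v]` is `ℋ¹`-null, then almost every
parameter of the segment avoids `A`. -/
theorem ae_add_smul_notMem_of_hausdorffMeasure_segment {V : Type*} [NormedAddCommGroup V]
    [NormedSpace ℝ V] [MeasurableSpace V] [BorelSpace V] {z v : V} (hv : v ≠ 0) {A : Set V}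
    (h : μH[1] (segment ℝ z (z + v) ∩ A) = 0) :
    ∀ᵐ s : ℝ, s ∈ Ioo (0 : ℝ) 1 → z + s • v ∉ A := by
  have hanti : AntilipschitzWith ‖v‖₊⁻¹ (fun s : ℝ => z + s • v) := by
    refine AntilipschitzWith.of_le_mul_dist fun a b => ?_
    have : 0 < ‖v‖ := norm_pos_iff.2 hv
    rw [dist_add_left, dist_eq_norm (a • v), ← sub_smul, norm_smul, ← dist_eq_norm]
    simp only [NNReal.coe_inv, coe_nnnorm]
    field_simp
    exact le_rfl
  have h0 := hanti.hausdorffMeasure_preimage_le (zero_le_one (α := ℝ))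
    (segment ℝ z (z + v) ∩ A)
  rw [h, mul_zero, hausdorffMeasure_real, nonpos_iff_eq_zero] at h0
  refine measure_mono_null (fun s hs => ?_) h0
  simp only [mem_compl_iff, mem_ofPred_eq, Classical.not_imp, not_not] at hs
  refine ⟨?_, hs.2⟩
  rw [segment_eq_image']
  exact ⟨s, Ioo_subset_Icc_self hs.1, by simp⟩

/-- If almost all segments `[z, z + (x - y)]` with endpoints in `E` and `z` near `y` stay almost
everywhere in `E` near `t • x + (1 - t) • y`, then the complement of `E` near that point is
controlled by the complement of `E` near the endpoints. -/
theorem volume_ball_diff_le_of_segments {n : ℕ} {E : Set (EuclideanSpace ℝ (Fin n))}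
    (hE : MeasurableSet E) {x y : EuclideanSpace ℝ (Fin n)} (hxy : x ≠ y)
    {t r : ℝ} (ht0 : 0 < t) (ht1 : t < 1) (hr : 0 < r)
    (hseg : ∀ᵐ z ∂(volume : Measure (EuclideanSpace ℝ (Fin n))),
      (z ∈ Metric.ball y (2 * r) ∧ z ∈ E ∧ z + (x - y) ∈ E) →
        μH[1] ((segment ℝ z (z + (x - y)) ∩
          Metric.ball (t • x + (1 - t) • y) (2 * r)) \ E) = 0) :
    volume (Metric.ball (t • x + (1 - t) • y) r \ E) ≤
      volume (Metric.ball y (2 * r) \ E) + volume (Metric.ball x (2 * r) \ E) := by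
  set p := t • x + (1 - t) • y with hp
  set v := x - y with hv
  have hv0 : v ≠ 0 := sub_ne_zero.2 hxy
  have hvpos : 0 < ‖v‖ := norm_pos_iff.2 hv0
  let S : Set (EuclideanSpace ℝ (Fin n)) := Metric.ball y (2 * r) ∩ (E ∩ (· + v) ⁻¹' E)
  have hS : MeasurableSet S :=
    measurableSet_ball.inter (hE.inter (measurable_add_const v hE))
  let A : Set (EuclideanSpace ℝ (Fin n)) := Metric.ball p (2 * r) \ E
  have hA : MeasurableSet A := measurableSet_ball.diff hE
  have hfub : ∀ᵐ z : EuclideanSpace ℝ (Fin n), ∀ᵐ s : ℝ,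
      ¬ (z ∈ S ∧ s ∈ Ioo (0 : ℝ) 1 ∧ z + s • v ∈ A) := by
    filter_upwards [hseg] with z hz
    by_cases hzS : z ∈ S
    · have h0 := hz hzS
      rw [inter_sdiff_assoc] at h0
      filter_upwards [ae_add_smul_notMem_of_hausdorffMeasure_segment hv0 h0] with s hs h
      exact hs h.2.1 h.2.2
    · exact Eventually.of_forall fun s h => hzS h.1
  have hmeas : MeasurableSet {q : EuclideanSpace ℝ (Fin n) × ℝ |
      ¬ (q.1 ∈ S ∧ q.2 ∈ Ioo (0 : ℝ) 1 ∧ q.1 + q.2 • v ∈ A)} := by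
    have hf : Measurable fun q : EuclideanSpace ℝ (Fin n) × ℝ => q.1 + q.2 • v := by fun_prop
    exact ((measurable_fst hS).inter ((measurable_snd measurableSet_Ioo).inter (hf hA))).compl
  have hfub' := (Measure.ae_ae_comm hmeas).1 hfub
  obtain ⟨s, ⟨hs01, hst⟩, hs⟩ := (Measure.dense_of_ae hfub').inter_open_nonempty
    (Ioo (0 : ℝ) 1 ∩ Metric.ball t (r / ‖v‖)) (isOpen_Ioo.inter Metric.isOpen_ball)
    ⟨t, ⟨ht0, ht1⟩, Metric.mem_ball_self (div_pos hr hvpos)⟩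
  rw [← measure_preimage_add_right volume (s • v) (Metric.ball p r \ E),
    ← measure_preimage_add_right volume v (Metric.ball x (2 * r) \ E)]
  refine (measure_mono_ae ?_).trans (measure_union_le _ _)
  filter_upwards [hs] with z hz
  rintro ⟨hzp, hzE⟩
  have hzy : z ∈ Metric.ball y (2 * r) := by
    rw [mem_ball_iff_norm] at hzp ⊢
    have hst' : ‖(t - s) • v‖ < r := by
      rw [Metric.mem_ball, dist_comm, Real.dist_eq, lt_div_iff₀ hvpos] at hst
      rwa [norm_smul, Real.norm_eq_abs]
    have : z - y = (z + s • v - p) + (t - s) • v := by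
      rw [hp, hv]; module
    rw [this]
    linarith [norm_add_le (z + s • v - p) ((t - s) • v)]
  by_cases h1 : z ∈ E
  · refine Or.inr ⟨?_, fun h2 => hz ⟨⟨hzy, h1, h2⟩, hs01, ?_, hzE⟩⟩
    · rw [mem_ball_iff_norm] at hzy ⊢
      rwa [show z + v - x = z - y by rw [hv]; abel]
    · exact Metric.ball_subset_ball (by linarith) hzp
  · exact Or.inl ⟨hzy, h1⟩

/-- If `x, y` are density-one points of `E` and, for a.e. `z` near `y` with
`z ∈ E ∩ (E - (x-y))`, the segment `[z, z+(x-y)]` meets the complement of `E` in an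
`ℋ¹`-null set near any point of the segment, then every convex combination
`t x + (1-t) y`, `t ∈ (0,1)`, is a density-one point of `E`. -/
theorem densityOne_of_segments {n : ℕ} (E : Set (EuclideanSpace ℝ (Fin n)))
    (hE : MeasurableSet E)
    (x y : EuclideanSpace ℝ (Fin n))
    (hx : x ∈ densityOne E) (hy : y ∈ densityOne E)
    (hseg : ∀ t : ℝ, 0 < t → t < 1 → ∀ r : ℝ, 0 < r →
      ∀ᵐ z ∂(volume : Measure (EuclideanSpace ℝ (Fin n))),
        (z ∈ Metric.ball y r ∧ z ∈ E ∧ z + (x - y) ∈ E) →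
          μH[1] ((segment ℝ z (z + (x - y)) ∩
            Metric.ball (t • x + (1 - t) • y) r) \ E) = 0) :
    ∀ t : ℝ, 0 < t → t < 1 → t • x + (1 - t) • y ∈ densityOne E := by
  intro t ht0 ht1
  rcases eq_or_ne x y with rfl | hxy
  · rwa [← add_smul, add_sub_cancel, one_smul]
  rw [mem_densityOne_iff hE] at hx hy ⊢
  have h2 : Tendsto (fun r : ℝ => 2 * r) (nhdsWithin 0 (Ioi 0)) (nhdsWithin 0 (Ioi 0)) := by
    refine tendsto_nhdsWithin_iff.2 ⟨?_, ?_⟩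
    · have : Tendsto (fun r : ℝ => 2 * r) (nhds 0) (nhds (2 * 0)) := tendsto_id.const_mul 2
      rw [mul_zero] at this
      exact this.mono_left nhdsWithin_le_nhds
    · filter_upwards [self_mem_nhdsWithin] with r hr
      exact mul_pos two_pos (mem_Ioi.1 hr)
  set c : ENNReal := ENNReal.ofReal (2 ^ n) with hc
  have hlim := ENNReal.Tendsto.const_mul (a := c) ((hy.comp h2).add (hx.comp h2))
    (Or.inr ENNReal.ofReal_ne_top)
  rw [add_zero, mul_zero] at hlim
  refine tendsto_of_tendsto_of_tendsto_of_le_of_le' tendsto_const_nhds hlim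
    (Eventually.of_forall fun _ => zero_le) ?_
  filter_upwards [self_mem_nhdsWithin] with r hr
  have hr : 0 < r := hr
  have hle := volume_ball_diff_le_of_segments hE hxy ht0 ht1 hr
    (hseg t ht0 ht1 (2 * r) (by positivity))
  have hball : ∀ q w : EuclideanSpace ℝ (Fin n),
      volume (Metric.ball q (2 * r)) = c * volume (Metric.ball w r) := by
    intro q w
    rw [Measure.addHaar_ball_mul_of_pos volume q two_pos r, finrank_euclideanSpace_fin,
      Measure.addHaar_ball_center volume w]
  have hc0 : c ≠ 0 := (ENNReal.ofReal_pos.2 (by positivity)).ne'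
  simp only [Function.comp_apply]
  rw [hball y (t • x + (1 - t) • y), hball x (t • x + (1 - t) • y), ← ENNReal.add_div,
    ← mul_div_assoc, ENNReal.mul_div_mul_left _ _ hc0 ENNReal.ofReal_ne_top]
  exact ENNReal.div_le_div_right hle _
end
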